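/- Let μ, ν ∈ P₁((0,∞)) with μ ≤_c ν, and let c : (0,∞)² → [0,∞] be Borel measurable. Define S*(c)(x₀,x₁) := x₁ · c(1/x₀, 1/x₁). Then (1/b(μ)) · inf{ ∫ S*(c) dπ : π ∈ M(μ,ν) } = inf{ ∫ c dπ̂ : π̂ ∈ M(S(μ),S(ν)) }, and a coupling π ∈ M(μ,ν) attains the infimum on the left-hand side if and only if S(π) attains the infimum on the right-hand side. -/

import Mathlib

open MeasureTheory Set

/-- Barycenter of a measure on `ℝ`. -/
noncomputable def bary (mu : Measure ℝ) : ℝ := ∫ x, x ∂mu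

/-- `mu ∈ P₁((0,∞))`: Borel probability measure on `ℝ` concentrated on `(0,∞)`
with finite first moment. -/
def MemP1 (mu : Measure ℝ) : Prop :=
  IsProbabilityMeasure mu ∧ mu (Set.Ioi (0:ℝ))ᶜ = 0 ∧ Integrable id mu

/-- Change-of-numeraire transform of a measure on `ℝ`:
`S(mu)(B) = (1/b(mu)) ∫ x · 1_B(1/x) dmu(x)`. -/
noncomputable def S (mu : Measure ℝ) : Measure ℝ :=
  (ENNReal.ofReal (bary mu))⁻¹ •
    ((mu.withDensity fun x => ENNReal.ofReal x).map fun x => x⁻¹)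

/-- Change-of-numeraire transform of a measure on `ℝ × ℝ`:
`S(π)(B) = (∫ x₁ · 1_B(1/x₀,1/x₁) dπ) / (∫ x₁ dπ)`. -/
noncomputable def S2 (pi : Measure (ℝ × ℝ)) : Measure (ℝ × ℝ) :=
  (ENNReal.ofReal (∫ p, p.2 ∂pi))⁻¹ •
    ((pi.withDensity fun p => ENNReal.ofReal p.2).map fun p => (p.1⁻¹, p.2⁻¹))

/-- `π ∈ M(μ,ν)`: martingale coupling of `μ` and `ν`, i.e. a probability measure on
`(0,∞)²` with first marginal `μ`, second marginal `ν`, such that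
`∫ f(x₀)(x₁ - x₀) dπ = 0` for all bounded Borel `f`. -/
def IsMC (mu nu : Measure ℝ) (pi : Measure (ℝ × ℝ)) : Prop :=
  IsProbabilityMeasure pi ∧
  pi ((Set.Ioi (0:ℝ) ×ˢ Set.Ioi (0:ℝ))ᶜ) = 0 ∧
  pi.map Prod.fst = mu ∧ pi.map Prod.snd = nu ∧
  ∀ f : ℝ → ℝ, Measurable f → (∃ M, ∀ x, |f x| ≤ M) →
    ∫ p, f p.1 * (p.2 - p.1) ∂pi = 0


/-- Convex order: `∫ φ dμ ≤ ∫ φ dν` for every convex `φ` for which both integrals exist. -/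
def ConvexOrder (mu nu : Measure ℝ) : Prop :=
  ∀ phi : ℝ → ℝ, ConvexOn ℝ Set.univ phi → Integrable phi mu → Integrable phi nu →
    ∫ x, phi x ∂mu ≤ ∫ x, phi x ∂nu

/-- The transformed cost `S*(c)(x₀,x₁) = x₁ · c(1/x₀, 1/x₁)`. -/
noncomputable def Sstar (c : ℝ × ℝ → ENNReal) : ℝ × ℝ → ENNReal :=
  fun p => ENNReal.ofReal p.2 * c (p.1⁻¹, p.2⁻¹)

lemma MemP1.ae_pos {mu : Measure ℝ} (h : MemP1 mu) : ∀ᵐ x ∂mu, 0 < x := by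
  have := h.2.1
  rw [← mem_ae_iff] at this
  exact this

lemma MemP1.ofReal_bary {mu : Measure ℝ} (h : MemP1 mu) :
    ENNReal.ofReal (bary mu) = ∫⁻ x, ENNReal.ofReal x ∂mu :=
  ofReal_integral_eq_lintegral_ofReal h.2.2 (h.ae_pos.mono fun _ hx => hx.le)

lemma MemP1.ofReal_bary_ne_zero {mu : Measure ℝ} (h : MemP1 mu) :
    ENNReal.ofReal (bary mu) ≠ 0 := by
  have := h.1
  rw [h.ofReal_bary, Ne, lintegral_eq_zero_iff ENNReal.measurable_ofReal]
  intro h0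
  have hF : ∀ᵐ x ∂mu, False := by
    filter_upwards [h0, h.ae_pos] with x hx hx'
    simp only [Pi.zero_apply, ENNReal.ofReal_eq_zero] at hx
    linarith
  obtain ⟨x, hx⟩ := hF.exists
  exact hx

lemma ofReal_mul_ofReal_inv {x : ℝ} (hx : 0 < x) :
    ENNReal.ofReal x * ENNReal.ofReal x⁻¹ = 1 := by
  rw [← ENNReal.ofReal_mul hx.le, mul_inv_cancel₀ hx.ne', ENNReal.ofReal_one]

lemma lintegral_S (mu : Measure ℝ) {g : ℝ → ENNReal} (hg : Measurable g) :
    ∫⁻ x, g x ∂(S mu)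
      = (ENNReal.ofReal (bary mu))⁻¹ * ∫⁻ x, ENNReal.ofReal x * g x⁻¹ ∂mu := by
  have hT : Measurable fun x : ℝ => x⁻¹ := measurable_inv
  rw [S, lintegral_smul_measure, lintegral_map hg hT,
    lintegral_withDensity_eq_lintegral_mul _ (by fun_prop) (by fun_prop)]
  rfl

lemma lintegral_S2 (pi : Measure (ℝ × ℝ)) {g : ℝ × ℝ → ENNReal} (hg : Measurable g) :
    ∫⁻ p, g p ∂(S2 pi)
      = (ENNReal.ofReal (∫ p, p.2 ∂pi))⁻¹ * ∫⁻ p, Sstar g p ∂pi := by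
  have hT : Measurable fun p : ℝ × ℝ => (p.1⁻¹, p.2⁻¹) := by fun_prop
  rw [S2, lintegral_smul_measure, lintegral_map hg hT,
    lintegral_withDensity_eq_lintegral_mul _ (by fun_prop) (by fun_prop)]
  rfl

lemma measure_ext_of_lintegral {α : Type*} [MeasurableSpace α] {m m' : Measure α}
    (h : ∀ g : α → ENNReal, Measurable g → ∫⁻ x, g x ∂m = ∫⁻ x, g x ∂m') : m = m' := by
  ext s hs
  have := h (s.indicator 1) (measurable_one.indicator hs)
  rwa [lintegral_indicator_one hs, lintegral_indicator_one hs] at this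

lemma MemP1.lintegral_ofReal_S {mu : Measure ℝ} (h : MemP1 mu) :
    ∫⁻ x, ENNReal.ofReal x ∂(S mu) = (ENNReal.ofReal (bary mu))⁻¹ := by
  have := h.1
  rw [lintegral_S mu ENNReal.measurable_ofReal,
    lintegral_congr_ae (h.ae_pos.mono fun x hx => ofReal_mul_ofReal_inv hx)]
  simp

lemma MemP1.memP1_S {mu : Measure ℝ} (h : MemP1 mu) : MemP1 (S mu) := by
  have h0 : S mu (Set.Ioi (0:ℝ))ᶜ = 0 := by
    have hm : MeasurableSet (Set.Ioi (0:ℝ))ᶜ := measurableSet_Ioi.compl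
    rw [← lintegral_indicator_one hm, lintegral_S mu (measurable_one.indicator hm)]
    rw [lintegral_congr_ae (g := fun _ => 0)]
    · simp
    · filter_upwards [h.ae_pos] with x hx
      simp [hx]
  refine ⟨⟨?_⟩, h0, ?_⟩
  · rw [← lintegral_one, lintegral_S mu measurable_const]
    simp only [mul_one]
    rw [← h.ofReal_bary]
    exact ENNReal.inv_mul_cancel h.ofReal_bary_ne_zero ENNReal.ofReal_ne_top
  · refine ⟨measurable_id.aestronglyMeasurable, ?_⟩
    rw [hasFiniteIntegral_iff_ofReal]
    · simp only [id]
      rw [h.lintegral_ofReal_S]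
      exact ENNReal.inv_lt_top.2 (pos_iff_ne_zero.2 h.ofReal_bary_ne_zero)
    · rw [← mem_ae_iff] at h0
      filter_upwards [h0] with x hx
      exact (show (0:ℝ) < x from hx).le

lemma MemP1.ofReal_bary_S {mu : Measure ℝ} (h : MemP1 mu) :
    ENNReal.ofReal (bary (S mu)) = (ENNReal.ofReal (bary mu))⁻¹ := by
  rw [h.memP1_S.ofReal_bary, h.lintegral_ofReal_S]

lemma MemP1.S_S {mu : Measure ℝ} (h : MemP1 mu) : S (S mu) = mu := by
  refine measure_ext_of_lintegral fun g hg => ?_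
  rw [lintegral_S _ hg, h.ofReal_bary_S, lintegral_S mu (by fun_prop), inv_inv, ← mul_assoc,
    ENNReal.mul_inv_cancel h.ofReal_bary_ne_zero ENNReal.ofReal_ne_top, one_mul]
  refine lintegral_congr_ae ?_
  filter_upwards [h.ae_pos] with x hx
  rw [← mul_assoc, ofReal_mul_ofReal_inv hx, one_mul, inv_inv]

section Coupling

variable {mu nu : Measure ℝ} {pi : Measure (ℝ × ℝ)}

lemma IsMC.ae_pos (h : IsMC mu nu pi) : ∀ᵐ p ∂pi, 0 < p.1 ∧ 0 < p.2 := by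
  have := h.2.1
  rw [← mem_ae_iff] at this
  exact this

lemma IsMC.integrable_fst (hmu : MemP1 mu) (h : IsMC mu nu pi) :
    Integrable (fun p => p.1) pi := by
  have := hmu.2.2
  rw [← h.2.2.1] at this
  exact this.comp_measurable measurable_fst

lemma IsMC.integrable_snd (hnu : MemP1 nu) (h : IsMC mu nu pi) :
    Integrable (fun p => p.2) pi := by
  have := hnu.2.2
  rw [← h.2.2.2.1] at this
  exact this.comp_measurable measurable_snd

lemma IsMC.integral_snd (h : IsMC mu nu pi) : ∫ p, p.2 ∂pi = bary nu := by
  rw [bary, ← h.2.2.2.1]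
  exact (integral_map measurable_snd.aemeasurable
    measurable_id.aestronglyMeasurable).symm

lemma IsMC.integral_fst (h : IsMC mu nu pi) : ∫ p, p.1 ∂pi = bary mu := by
  rw [bary, ← h.2.2.1]
  exact (integral_map measurable_fst.aemeasurable
    measurable_id.aestronglyMeasurable).symm

lemma IsMC.bary_eq (hmu : MemP1 mu) (hnu : MemP1 nu) (h : IsMC mu nu pi) :
    bary nu = bary mu := by
  have := h.2.2.2.2 (fun _ => 1) measurable_const ⟨1, by simp⟩
  simp only [one_mul] at this
  rw [integral_sub (h.integrable_snd hnu) (h.integrable_fst hmu), h.integral_snd,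
    h.integral_fst] at this
  linarith

/-- The martingale property tested against arbitrary nonnegative measurable functions. -/
lemma IsMC.lintegral_martingale (hmu : MemP1 mu) (hnu : MemP1 nu) (h : IsMC mu nu pi)
    {g : ℝ → ENNReal} (hg : Measurable g) :
    ∫⁻ p, ENNReal.ofReal p.2 * g p.1 ∂pi = ∫⁻ p, ENNReal.ofReal p.1 * g p.1 ∂pi := by
  have h1 := h.integrable_fst hmu
  have h2 := h.integrable_snd hnu
  have hm : (pi.withDensity fun p => ENNReal.ofReal p.2).map Prod.fst
      = (pi.withDensity fun p => ENNReal.ofReal p.1).map Prod.fst := by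
    ext B hB
    have hB' : MeasurableSet (Prod.fst ⁻¹' B : Set (ℝ × ℝ)) := measurable_fst hB
    rw [Measure.map_apply measurable_fst hB, Measure.map_apply measurable_fst hB,
      withDensity_apply _ hB', withDensity_apply _ hB',
      ← ofReal_integral_eq_lintegral_ofReal h2.integrableOn
        (ae_restrict_of_ae (h.ae_pos.mono fun p hp => hp.2.le)),
      ← ofReal_integral_eq_lintegral_ofReal h1.integrableOn
        (ae_restrict_of_ae (h.ae_pos.mono fun p hp => hp.1.le))]
    have key := h.2.2.2.2 (B.indicator fun _ => 1) (measurable_const.indicator hB)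
      ⟨1, fun x => by by_cases hx : x ∈ B <;> simp [hx]⟩
    have e : (fun p : ℝ × ℝ => B.indicator (fun _ => (1:ℝ)) p.1 * (p.2 - p.1))
        = (Prod.fst ⁻¹' B).indicator fun p => p.2 - p.1 := by
      ext p
      by_cases hp : p.1 ∈ B <;> simp [hp, Set.indicator]
    rw [e, integral_indicator hB', integral_sub h2.integrableOn h1.integrableOn] at key
    rw [sub_eq_zero.1 key]
  have := congrArg (fun m => ∫⁻ x, g x ∂m) hm
  simp only [lintegral_map hg measurable_fst] at this
  rwa [lintegral_withDensity_eq_lintegral_mul _ (by fun_prop) (by fun_prop),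
    lintegral_withDensity_eq_lintegral_mul _ (by fun_prop) (by fun_prop)] at this

lemma integral_martingale_of_lintegral (hpos : ∀ᵐ p ∂pi, 0 < p.1 ∧ 0 < p.2)
    (h1 : Integrable (fun p => p.1) pi) (h2 : Integrable (fun p => p.2) pi)
    (h : ∀ g : ℝ → ENNReal, Measurable g →
      ∫⁻ p, ENNReal.ofReal p.2 * g p.1 ∂pi = ∫⁻ p, ENNReal.ofReal p.1 * g p.1 ∂pi)
    {f : ℝ → ℝ} (hf : Measurable f) {M : ℝ} (hM : ∀ x, |f x| ≤ M) :
    ∫ p, f p.1 * (p.2 - p.1) ∂pi = 0 := by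
  have nonneg_case : ∀ k : ℝ → ℝ, Measurable k → (∀ x, 0 ≤ k x) →
      ∫ p, p.2 * k p.1 ∂pi = ∫ p, p.1 * k p.1 ∂pi := by
    intro k hk hk0
    rw [integral_eq_lintegral_of_nonneg_ae
        (hpos.mono fun p hp => mul_nonneg hp.2.le (hk0 _)) (by fun_prop),
      integral_eq_lintegral_of_nonneg_ae
        (hpos.mono fun p hp => mul_nonneg hp.1.le (hk0 _)) (by fun_prop)]
    simp only [ENNReal.ofReal_mul' (hk0 _)]
    rw [h (fun x => ENNReal.ofReal (k x)) (by fun_prop)]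
  have hshift := nonneg_case (fun x => f x + M) (by fun_prop)
    fun x => by linarith [(abs_le.1 (hM x)).1]
  have hone := nonneg_case (fun _ => 1) measurable_const fun _ => zero_le_one
  simp only [mul_one] at hone
  have i1 : Integrable (fun p : ℝ × ℝ => p.1 * f p.1) pi :=
    h1.mul_bdd (c := M) (hf.comp measurable_fst).aestronglyMeasurable (.of_forall fun p => hM p.1)
  have i2 : Integrable (fun p : ℝ × ℝ => p.2 * f p.1) pi :=
    h2.mul_bdd (c := M) (hf.comp measurable_fst).aestronglyMeasurable (.of_forall fun p => hM p.1)
  simp only [mul_add] at hshift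
  rw [integral_add i2 (h2.mul_const M), integral_add i1 (h1.mul_const M),
    integral_mul_const, integral_mul_const, hone] at hshift
  simp only [mul_comm (f _), sub_mul]
  rw [integral_sub i2 i1]
  linarith

/-- The change of numeraire maps martingale couplings to martingale couplings. -/
lemma IsMC.isMC_S2 (hmu : MemP1 mu) (hnu : MemP1 nu) (h : IsMC mu nu pi) :
    IsMC (S mu) (S nu) (S2 pi) := by
  have hl : ∀ g : ℝ × ℝ → ENNReal, Measurable g →
      ∫⁻ p, g p ∂(S2 pi) = (ENNReal.ofReal (bary mu))⁻¹ * ∫⁻ p, Sstar g p ∂pi := by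
    intro g hg
    rw [lintegral_S2 pi hg, h.integral_snd, h.bary_eq hmu hnu]
  have hsnd : (S2 pi).map Prod.snd = S nu := by
    refine measure_ext_of_lintegral fun g hg => ?_
    rw [lintegral_map hg measurable_snd, hl _ (by fun_prop), lintegral_S _ hg,
      h.bary_eq hmu hnu, ← h.2.2.2.1, lintegral_map (by fun_prop) measurable_snd]
    rfl
  have hfst : (S2 pi).map Prod.fst = S mu := by
    refine measure_ext_of_lintegral fun g hg => ?_
    rw [lintegral_map hg measurable_fst, hl _ (by fun_prop), lintegral_S _ hg]
    congr 1
    refine (h.lintegral_martingale hmu hnu (g := fun x => g x⁻¹) (by fun_prop)).trans ?_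
    conv_rhs => rw [← h.2.2.1]
    rw [lintegral_map (by fun_prop) measurable_fst]
  have p1 : ∀ᵐ p ∂(S2 pi), 0 < p.1 :=
    ae_of_ae_map measurable_fst.aemeasurable (hfst ▸ hmu.memP1_S.ae_pos)
  have p2 : ∀ᵐ p ∂(S2 pi), 0 < p.2 :=
    ae_of_ae_map measurable_snd.aemeasurable (hsnd ▸ hnu.memP1_S.ae_pos)
  have hpos := p1.and p2
  have i1 : Integrable (fun p => p.1) (S2 pi) := by
    have := hmu.memP1_S.2.2
    rw [← hfst] at this
    exact this.comp_measurable measurable_fst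
  have i2 : Integrable (fun p => p.2) (S2 pi) := by
    have := hnu.memP1_S.2.2
    rw [← hsnd] at this
    exact this.comp_measurable measurable_snd
  refine ⟨?_, ?_, hfst, hsnd, ?_⟩
  · have := hmu.memP1_S.1
    rw [← hfst] at this
    exact (Measure.isProbabilityMeasure_map_iff measurable_fst.aemeasurable).1 this
  · rw [← mem_ae_iff]
    exact hpos
  · rintro f hf ⟨M, hM⟩
    refine integral_martingale_of_lintegral hpos i1 i2 (fun g hg => ?_) hf hM
    rw [hl _ (by fun_prop), hl _ (by fun_prop)]
    congr 1
    refine Eq.trans ?_ (h.lintegral_martingale hmu hnu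
      (g := fun x => ENNReal.ofReal x⁻¹ * g x⁻¹) (by fun_prop)).symm
    refine lintegral_congr_ae ?_
    filter_upwards [h.ae_pos] with p hp
    simp only [Sstar]
    rw [← mul_assoc, ← mul_assoc, ofReal_mul_ofReal_inv hp.1, ofReal_mul_ofReal_inv hp.2]

lemma IsMC.S2_S2 (hmu : MemP1 mu) (hnu : MemP1 nu) (h : IsMC mu nu pi) :
    S2 (S2 pi) = pi := by
  refine measure_ext_of_lintegral fun g hg => ?_
  have hS : Measurable (Sstar g) := by unfold Sstar; fun_prop
  rw [lintegral_S2 _ hg, (h.isMC_S2 hmu hnu).integral_snd, hnu.ofReal_bary_S, lintegral_S2 pi hS,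
    h.integral_snd, inv_inv, ← mul_assoc,
    ENNReal.mul_inv_cancel hnu.ofReal_bary_ne_zero ENNReal.ofReal_ne_top, one_mul]
  refine lintegral_congr_ae ?_
  filter_upwards [h.ae_pos] with p hp
  simp only [Sstar]
  rw [← mul_assoc, ofReal_mul_ofReal_inv hp.2, one_mul, inv_inv, inv_inv]

end Coupling

/-- change of numeraire for martingale optimal transport with cost `c`. -/
theorem stmt8 (mu nu : Measure ℝ) (hmu : MemP1 mu) (hnu : MemP1 nu)
    (hcvx : ConvexOrder mu nu)
    (c : ℝ × ℝ → ENNReal) (hc : Measurable c) :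
    (ENNReal.ofReal (bary mu))⁻¹ *
        sInf {r | ∃ pi, IsMC mu nu pi ∧ r = ∫⁻ p, Sstar c p ∂pi}
      = sInf {r | ∃ rho, IsMC (S mu) (S nu) rho ∧ r = ∫⁻ p, c p ∂rho} ∧
    ∀ pi, IsMC mu nu pi →
      ((∫⁻ p, Sstar c p ∂pi
          = sInf {r | ∃ pi', IsMC mu nu pi' ∧ r = ∫⁻ p, Sstar c p ∂pi'}) ↔
       (∫⁻ p, c p ∂(S2 pi)
          = sInf {r | ∃ rho, IsMC (S mu) (S nu) rho ∧ r = ∫⁻ p, c p ∂rho})) := by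
  have hcost : ∀ pi, IsMC mu nu pi →
      ∫⁻ p, c p ∂(S2 pi) = (ENNReal.ofReal (bary mu))⁻¹ * ∫⁻ p, Sstar c p ∂pi := by
    intro pi h
    rw [lintegral_S2 pi hc, h.integral_snd, h.bary_eq hmu hnu]
  have h0 : (ENNReal.ofReal (bary mu))⁻¹ ≠ 0 := ENNReal.inv_ne_zero.2 ENNReal.ofReal_ne_top
  have htop : (ENNReal.ofReal (bary mu))⁻¹ ≠ ⊤ := ENNReal.inv_ne_top.2 hmu.ofReal_bary_ne_zero
  have hset : {r | ∃ rho, IsMC (S mu) (S nu) rho ∧ r = ∫⁻ p, c p ∂rho}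
      = (fun r => (ENNReal.ofReal (bary mu))⁻¹ * r) ''
        {r | ∃ pi, IsMC mu nu pi ∧ r = ∫⁻ p, Sstar c p ∂pi} := by
    ext r
    constructor
    · rintro ⟨rho, hrho, rfl⟩
      have hpi := hrho.isMC_S2 hmu.memP1_S hnu.memP1_S
      rw [hmu.S_S, hnu.S_S] at hpi
      refine ⟨_, ⟨S2 rho, hpi, rfl⟩, ?_⟩
      simp only
      rw [← hcost _ hpi, hrho.S2_S2 hmu.memP1_S hnu.memP1_S]
    · rintro ⟨_, ⟨pi, hpi, rfl⟩, rfl⟩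
      exact ⟨S2 pi, hpi.isMC_S2 hmu hnu, (hcost pi hpi).symm⟩
  have hinf : (ENNReal.ofReal (bary mu))⁻¹ *
        sInf {r | ∃ pi, IsMC mu nu pi ∧ r = ∫⁻ p, Sstar c p ∂pi}
      = sInf {r | ∃ rho, IsMC (S mu) (S nu) rho ∧ r = ∫⁻ p, c p ∂rho} := by
    rw [hset, sInf_image, sInf_eq_iInf]
    simp only [ENNReal.mul_iInf_of_ne h0 htop]
  refine ⟨hinf, fun pi hpi => ?_⟩
  rw [← hinf, hcost pi hpi]
  exact (ENNReal.mul_right_inj h0 htop).symm
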